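/- Let q ∈ ℂ^× with q² ≠ 1, m ∈ ℤ with [m] ≠ 0, and in the blob algebra b_n(m) define L_k := (U_{k−1}+q)⋯(U_1+q)·((q−q^{−1})U_0 + q^m)·(U_1+q)⋯(U_{k−1}+q) for 1 ≤ k ≤ n, where U_0 := −[m]e. Then for all admissible indices: (i) L_k U_i = U_i L_k whenever k ∉ {i, i+1}; (ii) (U_k + q^{−1})L_{k+1} = L_k(U_k + q) for 1 ≤ k < n; and (iii) L_{k+1}(U_k + q^{−1}) = (U_k + q)L_k for 1 ≤ k < n. -/

import Mathlib

noncomputable section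

namespace Statement12

/-- The Gaussian integer `[j] = (q^j - q^{-j})/(q - q⁻¹)`. -/
def gauss (q : ℂ) (j : ℤ) : ℂ := (q ^ j - q ^ (-j)) / (q - q⁻¹)

/-- Generators of the blob algebra: `e` and `U_1, …, U_{n-1}` (0-indexed). -/
inductive BlobGen (n : ℕ) : Type
  | e : BlobGen n
  | U : Fin (n - 1) → BlobGen n

/-- The generator `e` in the free algebra. -/
def eF (n : ℕ) : FreeAlgebra ℂ (BlobGen n) := FreeAlgebra.ι ℂ BlobGen.e

/-- The generator `U_i` in the free algebra. -/
def UF (n : ℕ) (i : Fin (n - 1)) : FreeAlgebra ℂ (BlobGen n) :=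
  FreeAlgebra.ι ℂ (BlobGen.U i)

/-- The defining relations of the blob algebra `b_n(m)`; here `y_e = -[m-1]/[m]`. -/
inductive BlobRel (q : ℂ) (m : ℤ) (n : ℕ) :
    FreeAlgebra ℂ (BlobGen n) → FreeAlgebra ℂ (BlobGen n) → Prop
  | Usq (i : Fin (n - 1)) : BlobRel q m n (UF n i * UF n i) ((-(q + q⁻¹)) • UF n i)
  | UUU (i j : Fin (n - 1)) (h : i.val + 1 = j.val ∨ j.val + 1 = i.val) :
      BlobRel q m n (UF n i * UF n j * UF n i) (UF n i)
  | Ucomm (i j : Fin (n - 1)) (h : i.val + 1 < j.val ∨ j.val + 1 < i.val) :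
      BlobRel q m n (UF n i * UF n j) (UF n j * UF n i)
  | UeU (i : Fin (n - 1)) (h : i.val = 0) :
      BlobRel q m n (UF n i * eF n * UF n i) ((-(gauss q (m - 1) / gauss q m)) • UF n i)
  | ee : BlobRel q m n (eF n * eF n) (eF n)
  | Ue (i : Fin (n - 1)) (h : 1 ≤ i.val) : BlobRel q m n (UF n i * eF n) (eF n * UF n i)

/-- The blob algebra `b_n(m)`. -/
abbrev Blob (q : ℂ) (m : ℤ) (n : ℕ) := RingQuot (BlobRel q m n)

/-- The image of `e` in the blob algebra. -/
def emk (q : ℂ) (m : ℤ) (n : ℕ) : Blob q m n :=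
  RingQuot.mkAlgHom ℂ (BlobRel q m n) (eF n)

/-- The image of `U_i` in the blob algebra. -/
def Umk (q : ℂ) (m : ℤ) (n : ℕ) (i : Fin (n - 1)) : Blob q m n :=
  RingQuot.mkAlgHom ℂ (BlobRel q m n) (UF n i)

/-- The rescaled generator `U_0 = -[m]·e`. -/
def U0el (q : ℂ) (m : ℤ) (n : ℕ) : Blob q m n := (-(gauss q m)) • emk q m n

/-- `U_i` for a natural number index (junk value `0` out of range). -/
def Uel (q : ℂ) (m : ℤ) (n : ℕ) (i : ℕ) : Blob q m n :=
  if h : i < n - 1 then Umk q m n ⟨i, h⟩ else 0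

/-- The Jucys–Murphy elements of the blob algebra (0-indexed):
`Lel k` is `L_{k+1} = (U_k + q) ⋯ (U_1 + q)·((q - q⁻¹)U_0 + q^m)·(U_1 + q) ⋯ (U_k + q)`. -/
def Lel (q : ℂ) (m : ℤ) (n : ℕ) : ℕ → Blob q m n
  | 0 => (q - q⁻¹) • U0el q m n + algebraMap ℂ (Blob q m n) (q ^ m)
  | k + 1 =>
      (Uel q m n k + algebraMap ℂ (Blob q m n) q) * Lel q m n k *
        (Uel q m n k + algebraMap ℂ (Blob q m n) q)

section Relations

variable {A : Type*} [Ring A] [Algebra ℂ A] {q : ℂ} {u v : A}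

/-- `u + q` has right inverse `u + q⁻¹` when `u² = -(q + q⁻¹) u`. -/
lemma add_mul_add_inv (hq : q ≠ 0) (hu : u * u = (-(q + q⁻¹)) • u) :
    (u + algebraMap ℂ A q) * (u + algebraMap ℂ A q⁻¹) = 1 := by
  simp only [Algebra.algebraMap_eq_smul_one, add_mul, mul_add, hu, smul_mul_assoc,
    mul_smul_comm, one_mul, mul_one]
  match_scalars <;> field_simp <;> ring

/-- `u + q` has left inverse `u + q⁻¹` when `u² = -(q + q⁻¹) u`. -/
lemma add_inv_mul_add (hq : q ≠ 0) (hu : u * u = (-(q + q⁻¹)) • u) :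
    (u + algebraMap ℂ A q⁻¹) * (u + algebraMap ℂ A q) = 1 := by
  simp only [Algebra.algebraMap_eq_smul_one, add_mul, mul_add, hu, smul_mul_assoc,
    mul_smul_comm, one_mul, mul_one]
  match_scalars <;> field_simp <;> ring

/-- The braid relation for Temperley–Lieb generators, in the form `u g_v g_u = g_v g_u v`. -/
lemma braid_left (hq : q ≠ 0) (hu : u * u = (-(q + q⁻¹)) • u) (hv : v * v = (-(q + q⁻¹)) • v)
    (huv : u * v * u = u) (hvu : v * u * v = v) :
    u * ((v + algebraMap ℂ A q) * (u + algebraMap ℂ A q)) =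
      (v + algebraMap ℂ A q) * (u + algebraMap ℂ A q) * v := by
  simp only [mul_assoc] at huv hvu
  simp only [Algebra.algebraMap_eq_smul_one, add_mul, mul_add, hu, hv, huv, hvu, smul_mul_assoc,
    mul_smul_comm, one_mul, mul_one, smul_smul, mul_assoc, smul_add]
  match_scalars <;> field_simp <;> ring

/-- The braid relation for Temperley–Lieb generators, in the form `g_u g_v u = v g_u g_v`. -/
lemma braid_right (hq : q ≠ 0) (hu : u * u = (-(q + q⁻¹)) • u) (hv : v * v = (-(q + q⁻¹)) • v)
    (huv : u * v * u = u) (hvu : v * u * v = v) :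
    (u + algebraMap ℂ A q) * (v + algebraMap ℂ A q) * u =
      v * ((u + algebraMap ℂ A q) * (v + algebraMap ℂ A q)) :=
  (braid_left hq hv hu hvu huv).symm

end Relations

section Generators

variable (q : ℂ) (m : ℤ) (n : ℕ)

lemma Umk_mul_self (i : Fin (n - 1)) :
    Umk q m n i * Umk q m n i = (-(q + q⁻¹)) • Umk q m n i := by
  simpa [Umk] using RingQuot.mkAlgHom_rel ℂ (BlobRel.Usq (q := q) (m := m) i)

lemma Umk_mul_Umk_mul_Umk (i j : Fin (n - 1)) (h : i.val + 1 = j.val ∨ j.val + 1 = i.val) :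
    Umk q m n i * Umk q m n j * Umk q m n i = Umk q m n i := by
  simpa [Umk] using RingQuot.mkAlgHom_rel ℂ (BlobRel.UUU (q := q) (m := m) i j h)

lemma commute_Umk_Umk (i j : Fin (n - 1)) (h : i.val + 1 < j.val ∨ j.val + 1 < i.val) :
    Commute (Umk q m n i) (Umk q m n j) := by
  simpa [Umk, Commute, SemiconjBy] using
    RingQuot.mkAlgHom_rel ℂ (BlobRel.Ucomm (q := q) (m := m) i j h)

lemma commute_Umk_emk (i : Fin (n - 1)) (h : 1 ≤ i.val) :
    Commute (Umk q m n i) (emk q m n) := by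
  simpa [Umk, emk, Commute, SemiconjBy] using
    RingQuot.mkAlgHom_rel ℂ (BlobRel.Ue (q := q) (m := m) i h)

lemma Uel_val (i : Fin (n - 1)) : Uel q m n i.val = Umk q m n i := by
  simp [Uel]

lemma commute_Uel_Umk (k : ℕ) (i : Fin (n - 1)) (h : k + 1 < i.val ∨ i.val + 1 < k) :
    Commute (Uel q m n k) (Umk q m n i) := by
  unfold Uel
  split_ifs with hk
  · exact commute_Umk_Umk q m n ⟨k, hk⟩ i h
  · exact Commute.zero_left _

lemma commute_Lel_succ_Umk {k : ℕ} {i : Fin (n - 1)} (h : k + 1 < i.val ∨ i.val + 1 < k)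
    (hL : Commute (Lel q m n k) (Umk q m n i)) :
    Commute (Lel q m n (k + 1)) (Umk q m n i) := by
  have hg : Commute (Uel q m n k + algebraMap ℂ (Blob q m n) q) (Umk q m n i) :=
    (commute_Uel_Umk q m n k i h).add_left (Algebra.commutes q _)
  exact (hg.mul_left hL).mul_left hg

lemma commute_Lel_Umk_of_lt {k : ℕ} {i : Fin (n - 1)} (h : k < i.val) :
    Commute (Lel q m n k) (Umk q m n i) := by
  induction k with
  | zero =>
    exact (((commute_Umk_emk q m n i h).symm.smul_left _).smul_left _).add_left
      (Algebra.commutes (q ^ m) _)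
  | succ k ih => exact commute_Lel_succ_Umk q m n (Or.inl h) (ih (by omega))

lemma commute_Lel_add_two_Umk (hq : q ≠ 0) (i : Fin (n - 1)) (h : i.val + 1 < n - 1) :
    Commute (Lel q m n (i.val + 2)) (Umk q m n i) := by
  have hv : Uel q m n (i.val + 1) = Umk q m n ⟨i.val + 1, h⟩ := Uel_val q m n ⟨i.val + 1, h⟩
  have hc : Commute (Lel q m n i.val) (Umk q m n ⟨i.val + 1, h⟩) :=
    commute_Lel_Umk_of_lt q m n (Nat.lt_succ_self _)
  have hu := Umk_mul_self q m n i
  have hv' := Umk_mul_self q m n ⟨i.val + 1, h⟩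
  have huv := Umk_mul_Umk_mul_Umk q m n i ⟨i.val + 1, h⟩ (Or.inl rfl)
  have hvu := Umk_mul_Umk_mul_Umk q m n ⟨i.val + 1, h⟩ i (Or.inr rfl)
  have hl := braid_left hq hu hv' huv hvu
  have hr := braid_right hq hu hv' huv hvu
  simp only [Lel, Uel_val, hv]
  generalize Umk q m n ⟨i.val + 1, h⟩ = v at *
  generalize Umk q m n i = u at *
  generalize u + algebraMap ℂ (Blob q m n) q = gu at *
  generalize v + algebraMap ℂ (Blob q m n) q = gv at *
  generalize Lel q m n i.val = L at *
  calc gv * (gu * L * gu) * gv * u = gv * gu * L * (gu * gv * u) := by simp only [mul_assoc]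
    _ = gv * gu * (L * v) * (gu * gv) := by rw [hr]; simp only [mul_assoc]
    _ = (gv * gu * v) * L * (gu * gv) := by rw [hc.eq]; simp only [mul_assoc]
    _ = u * (gv * (gu * L * gu) * gv) := by rw [← hl]; simp only [mul_assoc]

lemma commute_Lel_Umk_of_gt (hq : q ≠ 0) {k : ℕ} (hk : k < n) {i : Fin (n - 1)}
    (h : i.val + 2 ≤ k) : Commute (Lel q m n k) (Umk q m n i) := by
  induction k, h using Nat.le_induction with
  | base => exact commute_Lel_add_two_Umk q m n hq i (by omega)
  | succ k h ih => exact commute_Lel_succ_Umk q m n (Or.inr h) (ih (by omega))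

end Generators

/-- Commutation relations between the Jucys–Murphy elements and the
generators `U_i` of the blob algebra (all indices 0-based: `L_k ↦ Lel (k-1)`,
`U_i ↦ Umk (i-1)`). -/
theorem statement12 (q : ℂ) (hq : q ≠ 0) (hq2 : q ^ 2 ≠ 1) (m : ℤ)
    (hm : gauss q m ≠ 0) (n : ℕ) :
    (∀ (k : Fin n) (i : Fin (n - 1)), k.val ≠ i.val → k.val ≠ i.val + 1 →
      Lel q m n k.val * Umk q m n i = Umk q m n i * Lel q m n k.val) ∧
    (∀ k : Fin (n - 1),
      (Umk q m n k + algebraMap ℂ (Blob q m n) q⁻¹) * Lel q m n (k.val + 1) =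
        Lel q m n k.val * (Umk q m n k + algebraMap ℂ (Blob q m n) q)) ∧
    (∀ k : Fin (n - 1),
      Lel q m n (k.val + 1) * (Umk q m n k + algebraMap ℂ (Blob q m n) q⁻¹) =
        (Umk q m n k + algebraMap ℂ (Blob q m n) q) * Lel q m n k.val) := by
  refine ⟨fun k i h₁ h₂ => ?_, fun k => ?_, fun k => ?_⟩
  · rcases lt_or_gt_of_ne h₁ with h | h
    · exact commute_Lel_Umk_of_lt q m n h
    · exact commute_Lel_Umk_of_gt q m n hq k.isLt (by omega)
  · rw [Lel, Uel_val, ← mul_assoc, ← mul_assoc, add_inv_mul_add hq (Umk_mul_self q m n k), one_mul]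
  · rw [Lel, Uel_val, mul_assoc, add_mul_add_inv hq (Umk_mul_self q m n k), mul_one]

end Statement12
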